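/- arXiv:2407.19608 — 3 statements merged into one kernel-verified Lean document; each statement's English description precedes it below -/
import Mathlib

section
/- (Nonvanishing conditions for all k.) Let M = (X, I) be a matroid with finite ground set X, let S_1, …, S_ℓ be a set partition of X (the S_i are pairwise disjoint and their union is X), and let c_1, …, c_ℓ be natural numbers. Then there exists an independent set A ∈ I with |A ∩ S_i| = c_i for all i ∈ [ℓ] if and only if for every nonempty subset L ⊆ [ℓ] one has rk(∪_{i∈L} S_i) ≥ Σ_{i∈L} c_i. -/
open Set

/-- The rank of a subset `S`: the size of a largest independent subset of `S`. -/
noncomputable def matRk {α : Type*} (M : Matroid α) (S : Set α) : ℕ :=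
  sSup {n : ℕ | ∃ I : Set α, M.Indep I ∧ I ⊆ S ∧ I.ncard = n}

section MatRk

variable {α : Type*} [Finite α] (M : Matroid α)

theorem cast_matRk (X : Set α) : (matRk M X : ℕ∞) = M.eRk X := by
  obtain ⟨B, hB⟩ := M.exists_isBasis' X
  have h_greatest :
      IsGreatest {n : ℕ | ∃ I : Set α, M.Indep I ∧ I ⊆ X ∧ I.ncard = n} B.ncard := by
    refine ⟨⟨B, hB.indep, hB.subset, rfl⟩, ?_⟩
    rintro n ⟨I, hI, hIX, rfl⟩
    have h := hI.encard_le_eRk_of_subset hIX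
    rw [← hB.encard_eq_eRk, ← I.toFinite.cast_ncard_eq, ← B.toFinite.cast_ncard_eq] at h
    exact_mod_cast h
  rw [matRk, h_greatest.csSup_eq, B.toFinite.cast_ncard_eq, hB.encard_eq_eRk]

variable {M}

theorem Matroid.IsBasis'.ncard_eq_matRk {I X : Set α} (h : M.IsBasis' I X) :
    I.ncard = matRk M X := by
  have h' := h.encard_eq_eRk
  rw [← cast_matRk, ← I.toFinite.cast_ncard_eq] at h'
  exact_mod_cast h'

theorem Matroid.Indep.ncard_le_matRk {I X : Set α} (hI : M.Indep I) (hIX : I ⊆ X) :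
    I.ncard ≤ matRk M X := by
  have h := hI.encard_le_eRk_of_subset hIX
  rw [← cast_matRk, ← I.toFinite.cast_ncard_eq] at h
  exact_mod_cast h

variable (M)

theorem matRk_mono {X Y : Set α} (h : X ⊆ Y) : matRk M X ≤ matRk M Y := by
  have h' := M.eRk_mono h
  rw [← cast_matRk, ← cast_matRk] at h'
  exact_mod_cast h'

theorem matRk_le_ncard (X : Set α) : matRk M X ≤ X.ncard := by
  have h := M.eRk_le_encard X
  rw [← cast_matRk, ← X.toFinite.cast_ncard_eq] at h
  exact_mod_cast h

theorem matRk_inter_add_matRk_union_le (X Y : Set α) :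
    matRk M (X ∩ Y) + matRk M (X ∪ Y) ≤ matRk M X + matRk M Y := by
  have h := M.eRk_inter_add_eRk_union_le X Y
  simp only [← cast_matRk] at h
  exact_mod_cast h

theorem matRk_le_matRk_diff_singleton_add_one (X : Set α) (x : α) :
    matRk M X ≤ matRk M (X \ {x}) + 1 := by
  have h := matRk_inter_add_matRk_union_le M (X \ {x}) {x}
  have h1 := matRk_le_ncard M {x}
  have h2 : matRk M X ≤ matRk M (X \ {x} ∪ {x}) := matRk_mono M (by simp)
  rw [ncard_singleton] at h1
  omega

theorem matRk_diff_singleton_lt_of_subset {X Y : Set α} {x : α} (hXY : X ⊆ Y) (hx : x ∈ X)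
    (h : matRk M (Y \ {x}) < matRk M Y) : matRk M (X \ {x}) < matRk M X := by
  have h_sub := matRk_inter_add_matRk_union_le M X (Y \ {x})
  have h_inter : X ∩ (Y \ {x}) = X \ {x} := by grind
  have h_union : X ∪ (Y \ {x}) = Y := by grind
  rw [h_inter, h_union] at h_sub
  omega

theorem matRk_diff_add_ncard_le {X T : Set α}
    (h : ∀ x ∈ T, matRk M (X \ {x}) < matRk M X) :
    matRk M (X \ T) + T.ncard ≤ matRk M X := by
  obtain ⟨I, hI⟩ := M.exists_isBasis' (X \ T)
  obtain ⟨J, hJ, hIJ⟩ := hI.indep.subset_isBasis'_of_subset (hI.subset.trans sdiff_subset)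
  have hTJ : T ⊆ J := by
    intro x hx
    by_contra hxJ
    have h_le := hJ.indep.ncard_le_matRk (subset_sdiff_singleton hJ.subset hxJ)
    have h_eq := hJ.ncard_eq_matRk
    have h_lt := h x hx
    omega
  have h_disj : Disjoint I T := disjoint_sdiff_left.mono_left hI.subset
  rw [← hI.ncard_eq_matRk, ← hJ.ncard_eq_matRk, ← ncard_union_eq h_disj]
  exact ncard_le_ncard (union_subset hIJ hTJ)

end MatRk

section Transversal

variable {α ι : Type*} {S : ι → Set α}

theorem iUnion_finset_inter_of_pairwise_disjoint [DecidableEq ι]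
    (hS : ∀ i j, i ≠ j → Disjoint (S i) (S j)) (L K : Finset ι) :
    (⋃ i ∈ L ∩ K, S i) = (⋃ i ∈ L, S i) ∩ ⋃ i ∈ K, S i := by
  ext x
  simp only [mem_iUnion, mem_inter_iff, Finset.mem_inter, exists_prop]
  constructor
  · rintro ⟨i, ⟨hL, hK⟩, hx⟩
    exact ⟨⟨i, hL, hx⟩, i, hK, hx⟩
  · rintro ⟨⟨i, hL, hx⟩, j, hK, hx'⟩
    obtain rfl : i = j := by
      by_contra h
      exact disjoint_left.1 (hS i j h) hx hx'
    exact ⟨i, ⟨hL, hK⟩, hx⟩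

theorem ncard_inter_iUnion_finset [Finite α] (hS : ∀ i j, i ≠ j → Disjoint (S i) (S j))
    (A : Set α) (L : Finset ι) :
    (A ∩ ⋃ i ∈ L, S i).ncard = ∑ i ∈ L, (A ∩ S i).ncard := by
  classical
  induction L using Finset.induction_on with
  | empty => simp
  | insert i L hi ih =>
    rw [Finset.sum_insert hi, Finset.set_biUnion_insert, inter_union_distrib_left,
      ncard_union_eq, ih]
    refine Disjoint.mono inter_subset_right inter_subset_right ?_
    simp only [disjoint_iUnion_right]
    exact fun j hj => hS i j (ne_of_mem_of_not_mem hj hi).symm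

/-- In a set `A` that is minimal subject to the rank inequalities, each part `S i` is met in at
most `c i` elements. -/
theorem ncard_inter_le_of_minimal [Finite α] (M : Matroid α)
    (hS : ∀ i j, i ≠ j → Disjoint (S i) (S j)) (c : ι → ℕ) {A : Set α}
    (hA : Minimal (fun A : Set α => ∀ L : Finset ι,
      ∑ i ∈ L, c i ≤ matRk M (A ∩ ⋃ i ∈ L, S i)) A) (i : ι) :
    (A ∩ S i).ncard ≤ c i := by
  classical
  by_contra! h_lt
  have h_tight : ∀ x ∈ A ∩ S i, ∃ L : Finset ι, i ∈ L ∧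
      matRk M (A ∩ ⋃ j ∈ L, S j) ≤ ∑ j ∈ L, c j ∧
      matRk M ((A ∩ ⋃ j ∈ L, S j) \ {x}) < matRk M (A ∩ ⋃ j ∈ L, S j) := by
    intro x hx
    have h_not := hA.not_prop_of_lt (sdiff_singleton_ssubset.2 hx.1)
    push Not at h_not
    obtain ⟨L, hL⟩ := h_not
    have h_eq : A \ {x} ∩ ⋃ j ∈ L, S j = (A ∩ ⋃ j ∈ L, S j) \ {x} := by grind
    rw [h_eq] at hL
    have h_le := hA.prop L
    have h_drop := matRk_le_matRk_diff_singleton_add_one M (A ∩ ⋃ j ∈ L, S j) x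
    refine ⟨L, ?_, by omega, by omega⟩
    by_contra hi
    have hx_notMem : x ∉ A ∩ ⋃ j ∈ L, S j := by
      simp only [mem_inter_iff, mem_iUnion, exists_prop, not_and, not_exists]
      exact fun _ j hj hxj =>
        disjoint_left.1 (hS i j (ne_of_mem_of_not_mem hj hi).symm) hx.2 hxj
    rw [sdiff_singleton_eq_self hx_notMem] at hL
    omega
  obtain ⟨y, hy⟩ : (A ∩ S i).Nonempty := nonempty_of_ncard_ne_zero (by omega)
  obtain ⟨K, hiK, hK, -⟩ := h_tight y hy
  obtain ⟨L, -, hL⟩ := exists_minimal_le_of_wellFoundedLT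
    (fun L : Finset ι => i ∈ L ∧ matRk M (A ∩ ⋃ j ∈ L, S j) ≤ ∑ j ∈ L, c j) K ⟨hiK, hK⟩
  obtain ⟨hiL, hL_tight⟩ := hL.prop
  have h_subset : A ∩ S i ⊆ A ∩ ⋃ j ∈ L, S j :=
    inter_subset_inter_right _ (subset_biUnion_of_mem (u := S) hiL)
  have h_coloop : ∀ x ∈ A ∩ S i,
      matRk M ((A ∩ ⋃ j ∈ L, S j) \ {x}) < matRk M (A ∩ ⋃ j ∈ L, S j) := by
    intro x hx
    obtain ⟨N, hiN, hN_tight, hN⟩ := h_tight x hx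
    have h_submod := matRk_inter_add_matRk_union_le M (A ∩ ⋃ j ∈ L, S j) (A ∩ ⋃ j ∈ N, S j)
    rw [← inter_inter_distrib_left, ← iUnion_finset_inter_of_pairwise_disjoint hS,
      ← inter_union_distrib_left, ← Finset.set_biUnion_union] at h_submod
    have h_union := hA.prop (L ∪ N)
    have h_sum := Finset.sum_union_inter (s₁ := L) (s₂ := N) (f := c)
    have h_le : L ≤ L ∩ N := hL.le_of_le
      ⟨Finset.mem_inter.2 ⟨hiL, hiN⟩, by omega⟩ Finset.inter_subset_left
    have hLN : L ⊆ N := h_le.trans Finset.inter_subset_right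
    exact matRk_diff_singleton_lt_of_subset M
      (inter_subset_inter_right _ (biUnion_mono hLN fun _ _ => subset_rfl)) (h_subset hx) hN
  have h_rk := matRk_diff_add_ncard_le M h_coloop
  have h_erase : matRk M (A ∩ ⋃ j ∈ L.erase i, S j) ≤
      matRk M ((A ∩ ⋃ j ∈ L, S j) \ (A ∩ S i)) := by
    refine matRk_mono M ?_
    rintro x ⟨hxA, hx⟩
    simp only [mem_iUnion, exists_prop, Finset.mem_erase] at hx
    obtain ⟨j, ⟨hji, hj⟩, hxj⟩ := hx
    exact ⟨⟨hxA, mem_biUnion (t := S) hj hxj⟩, fun h => disjoint_left.1 (hS j i hji) hxj h.2⟩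
  have h_prop := hA.prop (L.erase i)
  have h_sum := Finset.sum_erase_add L c hiL
  omega

/-- Rado's theorem for pairwise disjoint sets with multiplicities. -/
theorem exists_indep_ncard_inter_eq [Finite α] [Fintype ι] (M : Matroid α)
    (hS : ∀ i j, i ≠ j → Disjoint (S i) (S j)) (c : ι → ℕ)
    (h : ∀ L : Finset ι, ∑ i ∈ L, c i ≤ matRk M (⋃ i ∈ L, S i)) :
    ∃ A : Set α, M.Indep A ∧ ∀ i, (A ∩ S i).ncard = c i := by
  obtain ⟨A, hA⟩ := exists_minimal_of_wellFoundedLT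
    (fun A : Set α => ∀ L : Finset ι, ∑ i ∈ L, c i ≤ matRk M (A ∩ ⋃ i ∈ L, S i))
    ⟨univ, by simpa only [univ_inter] using h⟩
  have h_le := ncard_inter_le_of_minimal M hS c hA
  obtain ⟨I, hI⟩ := M.exists_isBasis' (A ∩ ⋃ i ∈ Finset.univ, S i)
  have h_sum := hA.prop Finset.univ
  have h_card := ncard_inter_iUnion_finset hS A Finset.univ
  have h_sum_le := Finset.sum_le_sum fun i (_ : i ∈ Finset.univ) => h_le i
  have h_eq : I = A ∩ ⋃ i ∈ Finset.univ, S i := by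
    refine eq_of_subset_of_ncard_le hI.subset ?_
    rw [hI.ncard_eq_matRk]
    omega
  refine ⟨I, hI.indep, fun i => ?_⟩
  have h_inter : I ∩ S i = A ∩ S i := by
    have h_sub : S i ⊆ ⋃ j ∈ Finset.univ, S j :=
      subset_biUnion_of_mem (u := S) (Finset.mem_univ i)
    rw [h_eq, inter_assoc, inter_eq_right.2 h_sub]
  rw [h_inter]
  refine (h_le i).antisymm ((hA.prop {i}).trans ?_)
  simpa using matRk_le_ncard M (A ∩ S i)

end Transversal

/-- **Nonvanishing conditions for all `k`.** For a set partition `S₁, …, S_ℓ` of the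
ground set, an independent set `A` with `|A ∩ S i| = c i` for all `i` exists iff
`rk(⋃_{i ∈ L} S i) ≥ ∑_{i ∈ L} c i` for every nonempty `L ⊆ [ℓ]`. -/
theorem nonvanishing_general {α : Type*} [Fintype α] (M : Matroid α) (ℓ : ℕ)
    (S : Fin ℓ → Set α)
    (hdisj : ∀ i j, i ≠ j → Disjoint (S i) (S j))
    (hcover : (⋃ i, S i) = M.E)
    (c : Fin ℓ → ℕ) :
    (∃ A : Set α, M.Indep A ∧ ∀ i, (A ∩ S i).ncard = c i) ↔
      ∀ L : Finset (Fin ℓ), L.Nonempty → ∑ i ∈ L, c i ≤ matRk M (⋃ i ∈ L, S i) := by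
  constructor
  · rintro ⟨A, hA, hc⟩ L -
    rw [← Finset.sum_congr rfl fun i _ => hc i, ← ncard_inter_iUnion_finset hdisj]
    exact (hA.subset inter_subset_left).ncard_le_matRk inter_subset_right
  · intro h
    refine exists_indep_ncard_inter_eq M hdisj c fun L => ?_
    obtain rfl | hL := L.eq_empty_or_nonempty
    · simp
    · exact h L hL
end

section
/- There exist constants C > 0 and K > 0 such that for all coprime positive integers A, B with C < B ≤ A ≤ 2B, there exists an integer m with 0 < m < B such that ŝ(m/A) ≤ K · (log A) · (log log A)² and ŝ((B−m)/A) ≤ K · (log A) · (log log A)². -/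
/-- `sHat m A` is `ŝ(m/A)`, the sum of the partial quotients in the continued
fraction expansion `m/A = [0; a₁, …, a_s]` produced by the Euclidean algorithm
(for `0 ≤ m < A`), with `ŝ(0) = 0`. -/
def sHat : ℕ → ℕ → ℕ
  | 0, _ => 0
  | (m + 1), A => A / (m + 1) + sHat (A % (m + 1)) (m + 1)
  termination_by m _ => m
  decreasing_by exact Nat.mod_lt _ (Nat.succ_pos m)

open Finset in
/-- The congruence `s * m ≡ r (mod A)` has at most `L` solutions with `0 ≤ m < A` and
`1 ≤ r ≤ L`. -/
lemma card_mul_congr_le (A : ℕ) (hA : 0 < A) (s : ℤ) (L : ℕ) :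
    #{p ∈ range A ×ˢ Icc 1 L | (A : ℤ) ∣ s * (p.1 : ℕ) - (p.2 : ℕ)} ≤ L := by
  obtain ⟨d, hd⟩ : ∃ d, d = Int.gcd A s := ⟨_, rfl⟩
  have hd0 : 0 < d := hd ▸ Int.gcd_pos_of_ne_zero_left _ (by exact_mod_cast hA.ne')
  obtain ⟨A', hA'⟩ : d ∣ A := by
    rw [hd]; exact_mod_cast Int.gcd_dvd_left (a := (A : ℤ)) (b := s)
  obtain ⟨s', hs'⟩ : (d : ℤ) ∣ s := hd ▸ Int.gcd_dvd_right (a := (A : ℤ)) (b := s)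
  have hA'0 : 0 < A' := Nat.pos_of_ne_zero fun h => by simp [h] at hA'; omega
  have hcop : Int.gcd (A' : ℤ) s' = 1 := by
    have h : d * 1 = d * Int.gcd (A' : ℤ) s' := by
      conv_lhs => rw [mul_one, hd, hA', hs', Nat.cast_mul, Int.gcd_mul_left, Int.natAbs_natCast]
    exact (Nat.eq_of_mul_eq_mul_left hd0 h).symm
  have hdvd : ∀ m r : ℕ, (A : ℤ) ∣ s * m - r → d ∣ r := by
    intro m r h
    have h1 : (d : ℤ) ∣ s * m - r := (Dvd.intro (A' : ℤ) (by rw [hA']; push_cast; rfl)).trans h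
    have h2 : (d : ℤ) ∣ s * m := Dvd.dvd.mul_right ⟨s', hs'⟩ _
    exact_mod_cast (dvd_sub_right h2).1 h1
  have hquot : ∀ m < A, m / A' < d := fun m hm =>
    Nat.div_lt_of_lt_mul (by rwa [hA', mul_comm] at hm)
  calc _ ≤ #(Icc 1 L) := by
        refine card_le_card_of_injOn (fun p => p.2 - p.1 / A') ?_ ?_
        · rintro ⟨m, r⟩ h
          simp only [coe_filter, mem_product, mem_range, mem_Icc, Set.mem_ofPred_eq] at h
          have := Nat.le_of_dvd (by omega) (hdvd m r h.2)
          have := hquot m h.1.1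
          simp only [coe_Icc, Set.mem_Icc]
          generalize m / A' = j at *
          omega
        · rintro ⟨m, r⟩ h ⟨m₂, r₂⟩ h₂ heq
          simp only [coe_filter, mem_product, mem_range, mem_Icc, Set.mem_ofPred_eq] at h h₂
          simp only at heq
          have hle := Nat.le_of_dvd (by omega) (hdvd m r h.2)
          have hle₂ := Nat.le_of_dvd (by omega) (hdvd m₂ r₂ h₂.2)
          have hj := hquot m h.1.1
          have hj₂ := hquot m₂ h₂.1.1
          obtain ⟨c, hc⟩ := hdvd m r h.2
          obtain ⟨c₂, hc₂⟩ := hdvd m₂ r₂ h₂.2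
          have hcc : c = c₂ := by
            generalize m / A' = j at *
            generalize m₂ / A' = j₂ at *
            by_contra hne
            rcases Nat.lt_or_gt_of_ne hne with hlt | hlt
            · have := Nat.mul_le_mul_left d hlt
              rw [Nat.succ_eq_add_one, mul_add, mul_one] at this
              omega
            · have := Nat.mul_le_mul_left d hlt
              rw [Nat.succ_eq_add_one, mul_add, mul_one] at this
              omega
          have hr : r = r₂ := by rw [hc, hc₂, hcc]
          have hjj : m / A' = m₂ / A' := by omega
          have h1 : (A : ℤ) ∣ s * (m - m₂) := by
            obtain ⟨e, he⟩ := h.2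
            obtain ⟨e₂, he₂⟩ := h₂.2
            rw [hr] at he
            exact ⟨e - e₂, by linear_combination he - he₂⟩
          have h2 : (A' : ℤ) ∣ s' * (m - m₂) := by
            rw [hA', hs', Nat.cast_mul, mul_assoc] at h1
            exact Int.dvd_of_mul_dvd_mul_left (by exact_mod_cast hd0.ne') h1
          have h3 : (A' : ℤ) ∣ m - m₂ := Int.dvd_of_dvd_mul_right_of_gcd_one h2 hcop
          have h4 : m₂ % A' = m % A' := (Nat.modEq_iff_dvd.2 h3)
          have h5 := Nat.div_add_mod m A'
          have h6 := Nat.div_add_mod m₂ A'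
          rw [hjj, ← h4] at h5
          rw [Prod.mk.injEq]
          exact ⟨by omega, hr⟩
    _ = L := by simp

open Finset in
/-- The number of `r ≥ 1` with `k * q * r ≤ A` and `q * m ≡ ± r (mod A)`. -/
def residueCount (A k q m : ℕ) : ℕ :=
  #{r ∈ Icc 1 (A / (k * q)) | (A : ℤ) ∣ (q : ℤ) * m - (r : ℕ) ∨ (A : ℤ) ∣ (q : ℤ) * m + (r : ℕ)}

open Finset in
lemma sum_residueCount_le (A : ℕ) (hA : 0 < A) (k q : ℕ) :
    ∑ m ∈ range A, residueCount A k q m ≤ 2 * (A / (k * q)) := by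
  have hcount : ∀ s : ℤ, ∑ m ∈ range A,
      #{r ∈ Icc 1 (A / (k * q)) | (A : ℤ) ∣ s * (m : ℕ) - (r : ℕ)} ≤ A / (k * q) := by
    intro s
    refine le_trans (le_of_eq ?_) (card_mul_congr_le A hA s (A / (k * q)))
    simp only [card_filter, sum_product]
  calc ∑ m ∈ range A, residueCount A k q m
      ≤ ∑ m ∈ range A, (#{r ∈ Icc 1 (A / (k * q)) | (A : ℤ) ∣ (q : ℤ) * m - (r : ℕ)} +
          #{r ∈ Icc 1 (A / (k * q)) | (A : ℤ) ∣ -(q : ℤ) * m - (r : ℕ)}) := by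
        refine sum_le_sum fun m _ => ?_
        rw [residueCount, filter_or]
        refine (card_union_le _ _).trans (le_of_eq ?_)
        congr 3
        ext r
        rw [← dvd_neg]
        ring_nf
    _ ≤ 2 * (A / (k * q)) := by
        rw [sum_add_distrib, two_mul]
        exact add_le_add (hcount _) (hcount _)

open Finset in
lemma div_le_sum_residueCount {A m T u v x : ℕ} (hv : 0 < v) (hx : 0 < x) (hxu : x * u ≤ A)
    (hxA : x ≤ A)
    (hT : ∀ q ∈ Icc 1 A, residueCount A (T + 1) q m = 0)
    (hdvd : (A : ℤ) ∣ (x : ℤ) * m - v ∨ (A : ℤ) ∣ (x : ℤ) * m + v) :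
    u / v ≤ ∑ k ∈ Icc 1 T, residueCount A k x m := by
  have hpos : ∀ k ∈ Icc 1 (u / v), 1 ≤ residueCount A k x m := by
    intro k hk
    rw [mem_Icc] at hk
    refine card_pos.2 ⟨v, mem_filter.2 ⟨mem_Icc.2 ⟨hv, ?_⟩, hdvd⟩⟩
    rw [Nat.le_div_iff_mul_le (Nat.mul_pos hk.1 hx)]
    calc v * (k * x) = x * (k * v) := by ring
      _ ≤ x * u := Nat.mul_le_mul_left x ((Nat.le_div_iff_mul_le hv).1 hk.2)
      _ ≤ A := hxu
  have hle : u / v ≤ T := by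
    by_contra! hlt
    have := hpos (T + 1) (mem_Icc.2 ⟨by omega, hlt⟩)
    have := hT x (mem_Icc.2 ⟨hx, hxA⟩)
    omega
  calc u / v = ∑ k ∈ Icc 1 (u / v), 1 := by simp
    _ ≤ ∑ k ∈ Icc 1 (u / v), residueCount A k x m := sum_le_sum hpos
    _ ≤ ∑ k ∈ Icc 1 T, residueCount A k x m :=
        sum_le_sum_of_subset (Icc_subset_Icc_right hle)

open Finset in
/-- Bound for the Euclidean algorithm started at consecutive remainders `u > v` of `(A, m)`
with cofactors `x` and `y`. -/
lemma sHat_le_sum_Icc_residueCount {A m T : ℕ}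
    (hT : ∀ q ∈ Icc 1 A, residueCount A (T + 1) q m = 0) (v : ℕ) :
    ∀ u x y : ℕ, v < u → 0 < x → 0 < y → x * u + y * v = A →
      ((A : ℤ) ∣ (x : ℤ) * m - v ∧ (A : ℤ) ∣ (y : ℤ) * m + u ∨
        (A : ℤ) ∣ (x : ℤ) * m + v ∧ (A : ℤ) ∣ (y : ℤ) * m - u) →
      sHat v u ≤ ∑ q ∈ Icc x A, ∑ k ∈ Icc 1 T, residueCount A k q m := by
  induction v using Nat.strong_induction_on with
  | _ v ih =>
    intro u x y hvu hx hy hA hdvd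
    rcases Nat.eq_zero_or_pos v with rfl | hv0
    · simp [sHat]
    have hsHat : sHat v u = u / v + sHat (u % v) v := by
      obtain ⟨w, rfl⟩ : ∃ w, v = w + 1 := ⟨v - 1, by omega⟩
      rw [sHat]
    rw [hsHat]
    have ha : 0 < u / v := Nat.div_pos hvu.le hv0
    have hxA : x ≤ A := by nlinarith
    have hu : v * (u / v) + u % v = u := Nat.div_add_mod u v
    have huZ : (v : ℤ) * (u / v : ℕ) + (u % v : ℕ) = u := by exact_mod_cast hu
    have hstep := ih (u % v) (Nat.mod_lt u hv0) v (u / v * x + y) x (Nat.mod_lt u hv0)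
      (by positivity) hx (by rw [← hA]; conv_rhs => rw [← hu]
                             ring) (by
        rcases hdvd with ⟨h1, h2⟩ | ⟨h1, h2⟩
        · refine Or.inr ⟨?_, h1⟩
          obtain ⟨e, he⟩ := h1
          obtain ⟨e₂, he₂⟩ := h2
          refine ⟨(u / v : ℕ) * e + e₂, ?_⟩
          push_cast at huZ ⊢
          linear_combination ((u : ℤ) / v) * he + he₂ + huZ
        · refine Or.inl ⟨?_, h1⟩
          obtain ⟨e, he⟩ := h1
          obtain ⟨e₂, he₂⟩ := h2
          refine ⟨(u / v : ℕ) * e + e₂, ?_⟩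
          push_cast at huZ ⊢
          linear_combination ((u : ℤ) / v) * he + he₂ - huZ)
    have hfirst := div_le_sum_residueCount hv0 hx (by omega : x * u ≤ A) hxA hT
      (hdvd.imp And.left And.left)
    have hxx : x + 1 ≤ u / v * x + y := by nlinarith
    calc u / v + sHat (u % v) v
        ≤ ∑ k ∈ Icc 1 T, residueCount A k x m +
          ∑ q ∈ Icc (x + 1) A, ∑ k ∈ Icc 1 T, residueCount A k q m :=
          add_le_add hfirst (hstep.trans (sum_le_sum_of_subset (Icc_subset_Icc_left hxx)))
      _ = ∑ q ∈ Icc x A, ∑ k ∈ Icc 1 T, residueCount A k q m := by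
          rw [← Finset.insert_Icc_add_one_left_eq_Icc hxA, sum_insert (by simp)]

open Finset in
lemma sHat_le_two_mul_sum_residueCount {A m T : ℕ} (hm : 0 < m) (hmA : m < A)
    (hT : ∀ q ∈ Icc 1 A, residueCount A (T + 1) q m = 0) :
    sHat m A ≤ 2 * ∑ q ∈ Icc 1 A, ∑ k ∈ Icc 1 T, residueCount A k q m := by
  have hfirst := div_le_sum_residueCount hm one_pos (one_mul A).le (by omega : 1 ≤ A) hT
    (by simp)
  have ha : 0 < A / m := Nat.div_pos hmA.le hm
  have hu : m * (A / m) + A % m = A := Nat.div_add_mod A m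
  have huZ : (m : ℤ) * (A / m : ℕ) + (A % m : ℕ) = A := by exact_mod_cast hu
  have hrest := sHat_le_sum_Icc_residueCount hT (A % m) m (A / m) 1 (Nat.mod_lt A hm) ha one_pos
    (by linarith) (Or.inr ⟨⟨1, by linarith⟩, by simp⟩)
  have hsub : ∑ q ∈ Icc (A / m) A, ∑ k ∈ Icc 1 T, residueCount A k q m ≤
      ∑ q ∈ Icc 1 A, ∑ k ∈ Icc 1 T, residueCount A k q m :=
    sum_le_sum_of_subset (Icc_subset_Icc_left ha)
  have hone : ∑ k ∈ Icc 1 T, residueCount A k 1 m ≤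
      ∑ q ∈ Icc 1 A, ∑ k ∈ Icc 1 T, residueCount A k q m :=
    single_le_sum (f := fun q => ∑ k ∈ Icc 1 T, residueCount A k q m)
      (fun _ _ => Nat.zero_le _) (mem_Icc.2 ⟨le_rfl, by omega⟩)
  obtain ⟨w, rfl⟩ : ∃ w, m = w + 1 := ⟨m - 1, by omega⟩
  rw [sHat]
  omega

open Finset in
lemma sum_sum_residueCount_le (A : ℕ) (hA : 0 < A) (k : ℕ) :
    ∑ m ∈ range A, ∑ q ∈ Icc 1 A, (residueCount A k q m : ℝ) ≤
      2 * A * (harmonic A : ℝ) * (k : ℝ)⁻¹ := by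
  rw [sum_comm, harmonic_eq_sum_Icc]
  push_cast
  rw [mul_sum, sum_mul]
  refine sum_le_sum fun q _ => ?_
  have h : (∑ m ∈ range A, residueCount A k q m : ℝ) ≤ 2 * (A / (k * q) : ℕ) := by
    exact_mod_cast sum_residueCount_le A hA k q
  refine h.trans ?_
  have h2 : ((A / (k * q) : ℕ) : ℝ) ≤ A / ((k * q : ℕ) : ℝ) := Nat.cast_div_le
  rw [Nat.cast_mul, div_eq_mul_inv, mul_inv] at h2
  linarith

open Finset in
/-- All but a tenth of the numerators `m` have a sum of partial quotients of order
`harmonic A * harmonic T`, where `T` is of order `harmonic A`. -/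
lemma card_sHat_gt_le (A T : ℕ) (hA : 0 < A) (hT : 40 * (harmonic A : ℝ) ≤ T) (hT0 : 0 < T) :
    (#{m ∈ Ico 1 A | 80 * (harmonic A : ℝ) * harmonic T < sHat m A} : ℝ) ≤ A / 10 := by
  have hA' : (0 : ℝ) < A := by exact_mod_cast hA
  have hH : (0 : ℝ) < harmonic A := by exact_mod_cast harmonic_pos hA.ne'
  have hHT : (0 : ℝ) < harmonic T := by exact_mod_cast harmonic_pos hT0.ne'
  set M : ℝ := 40 * (harmonic A : ℝ) * harmonic T with hM
  have hM0 : 0 < M := by positivity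
  set f : ℕ → ℝ := fun m => ∑ q ∈ Icc 1 A, (residueCount A (T + 1) q m : ℝ) with hf
  set g : ℕ → ℝ := fun m => ∑ k ∈ Icc 1 T, ∑ q ∈ Icc 1 A, (residueCount A k q m : ℝ) with hg
  have hf0 : ∀ m, 0 ≤ f m := fun m => sum_nonneg fun _ _ => by positivity
  have hg0 : ∀ m, 0 ≤ g m := fun m => sum_nonneg fun _ _ => sum_nonneg fun _ _ => by positivity
  have hfsum : ∑ m ∈ range A, f m ≤ A / 20 := by
    refine (sum_sum_residueCount_le A hA (T + 1)).trans ?_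
    rw [← div_eq_mul_inv, div_le_iff₀ (by positivity)]
    push_cast
    nlinarith
  have hgsum : ∑ m ∈ range A, g m ≤ M * (A / 20) := by
    rw [hg, sum_comm]
    calc _ ≤ ∑ k ∈ Icc 1 T, 2 * A * (harmonic A : ℝ) * (k : ℝ)⁻¹ :=
          sum_le_sum fun k _ => sum_sum_residueCount_le A hA k
      _ = M * (A / 20) := by
          rw [← mul_sum, hM, harmonic_eq_sum_Icc (n := T)]
          push_cast
          ring
  have hpoint : ∀ m ∈ Ico 1 A, 2 * M < sHat m A → 1 ≤ f m + g m / M := by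
    intro m hm hlt
    rw [mem_Ico] at hm
    by_cases h : ∀ q ∈ Icc 1 A, residueCount A (T + 1) q m = 0
    · have h1 : (sHat m A : ℝ) ≤ 2 * g m := by
        have := sHat_le_two_mul_sum_residueCount hm.1 hm.2 h
        rw [sum_comm] at this
        have := (Nat.cast_le (α := ℝ)).2 this
        push_cast at this
        exact this
      have h2 : 1 ≤ g m / M := by rw [le_div_iff₀ hM0]; linarith
      linarith [hf0 m]
    · push Not at h
      obtain ⟨q, hq, hne⟩ := h
      have h1 : (1 : ℝ) ≤ residueCount A (T + 1) q m := by
        exact_mod_cast Nat.one_le_iff_ne_zero.2 hne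
      have h2 : (residueCount A (T + 1) q m : ℝ) ≤ f m :=
        single_le_sum (f := fun q => (residueCount A (T + 1) q m : ℝ))
          (fun _ _ => by positivity) hq
      have := div_nonneg (hg0 m) hM0.le
      linarith
  have h2M : 80 * (harmonic A : ℝ) * harmonic T = 2 * M := by rw [hM]; ring
  rw [h2M]
  calc (#{m ∈ Ico 1 A | 2 * M < sHat m A} : ℝ)
      = ∑ m ∈ Ico 1 A with 2 * M < sHat m A, (1 : ℝ) := by simp
    _ ≤ ∑ m ∈ Ico 1 A with 2 * M < sHat m A, (f m + g m / M) :=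
        sum_le_sum fun m hm => hpoint m (mem_filter.1 hm).1 (mem_filter.1 hm).2
    _ ≤ ∑ m ∈ range A, (f m + g m / M) := by
        refine sum_le_sum_of_subset_of_nonneg ?_ fun m _ _ =>
          add_nonneg (hf0 m) (div_nonneg (hg0 m) hM0.le)
        intro m hm
        exact mem_range.2 (mem_Ico.1 (mem_filter.1 hm).1).2
    _ ≤ A / 20 + A / 20 := by
        rw [sum_add_distrib, ← sum_div]
        refine add_le_add hfsum ?_
        rw [div_le_iff₀ hM0]
        linarith
    _ = A / 10 := by ring

open Finset in
lemma exists_split_sHat_le (A B T : ℕ) (hA : 0 < A) (hT : 40 * (harmonic A : ℝ) ≤ T) (hT0 : 0 < T)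
    (hB : 1 < B) (hBA : B ≤ A) (hAB : A ≤ 2 * B) :
    ∃ m : ℕ, 0 < m ∧ m < B ∧ (sHat m A : ℝ) ≤ 80 * (harmonic A : ℝ) * harmonic T ∧
      (sHat (B - m) A : ℝ) ≤ 80 * (harmonic A : ℝ) * harmonic T := by
  by_contra! hcon
  have hcard := card_sHat_gt_le A T hA hT hT0
  set S : Finset ℕ := {m ∈ Ico 1 A | 80 * (harmonic A : ℝ) * harmonic T < sHat m A} with hS
  have hsub : Ico 1 B ⊆ S ∪ S.image (B - ·) := by
    intro m hm
    rw [mem_Ico] at hm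
    rw [mem_union, mem_image]
    by_cases h : (sHat m A : ℝ) ≤ 80 * (harmonic A : ℝ) * harmonic T
    · exact Or.inr ⟨B - m, mem_filter.2 ⟨mem_Ico.2 (by omega), hcon m hm.1 hm.2 h⟩, by omega⟩
    · exact Or.inl (mem_filter.2 ⟨mem_Ico.2 (by omega), not_le.1 h⟩)
  have hle : B - 1 ≤ #S + #S := by
    calc B - 1 = #(Ico 1 B) := by simp
      _ ≤ #(S ∪ S.image (B - ·)) := card_le_card hsub
      _ ≤ #S + #(S.image (B - ·)) := card_union_le _ _
      _ ≤ #S + #S := Nat.add_le_add_left card_image_le _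
  have h1 : (B : ℝ) ≤ #S + #S + 1 := by
    have : B ≤ #S + #S + 1 := by omega
    exact_mod_cast this
  have h2 : (A : ℝ) ≤ 2 * B := by exact_mod_cast hAB
  have h3 : (2 : ℝ) ≤ B := by exact_mod_cast hB
  linarith

/-- **Proposition 1.13 (number-theoretic estimate).** There are constants
`C, K > 0` such that every fraction `B/A` with `A, B` coprime and
`C < B ≤ A ≤ 2B` splits as `m/A + (B-m)/A` with both parts having small sums of
partial quotients. -/
theorem exists_small_quotient_split :
    ∃ C K : ℝ, 0 < C ∧ 0 < K ∧
      ∀ A B : ℕ, Nat.Coprime A B → C < (B : ℝ) → B ≤ A → A ≤ 2 * B →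
        ∃ m : ℕ, 0 < m ∧ m < B ∧
          (sHat m A : ℝ) ≤ K * Real.log A * (Real.log (Real.log A)) ^ 2 ∧
          (sHat (B - m) A : ℝ) ≤ K * Real.log A * (Real.log (Real.log A)) ^ 2 := by
  refine ⟨Real.exp 100, 480, Real.exp_pos _, by norm_num, ?_⟩
  intro A B _ hC hBA hAB
  have hBA' : (B : ℝ) ≤ A := by exact_mod_cast hBA
  have hB1 : (1 : ℝ) < B := (Real.one_lt_exp_iff.2 (by norm_num)).trans hC
  have hA0 : (0 : ℝ) < A := by linarith
  have hL : 100 < Real.log A := (Real.lt_log_iff_exp_lt hA0).2 (hC.trans_le hBA')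
  set L := Real.log A with hLdef
  have hll : 1 ≤ Real.log L := by
    rw [Real.le_log_iff_exp_le (by linarith)]
    linarith [Real.exp_one_lt_d9]
  have hH : (harmonic A : ℝ) ≤ 2 * L := by linarith [harmonic_le_one_add_log A]
  have hHpos : (0 : ℝ) < harmonic A := by
    exact_mod_cast harmonic_pos (Nat.cast_pos.1 hA0).ne'
  have hT0 : 0 < ⌈40 * (harmonic A : ℝ)⌉₊ := Nat.ceil_pos.2 (by positivity)
  set T := ⌈40 * (harmonic A : ℝ)⌉₊ with hTdef
  have hTle : (T : ℝ) ≤ L ^ 2 := by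
    have := Nat.ceil_lt_add_one (a := 40 * (harmonic A : ℝ)) (by positivity)
    nlinarith
  have hHT : (harmonic T : ℝ) ≤ 3 * Real.log L := by
    have h1 := Real.log_le_log (by exact_mod_cast hT0) hTle
    rw [Real.log_pow] at h1
    push_cast at h1
    linarith [harmonic_le_one_add_log T]
  have hHTpos : (0 : ℝ) < harmonic T := by exact_mod_cast harmonic_pos hT0.ne'
  have hbound : 80 * (harmonic A : ℝ) * harmonic T ≤ 480 * L * Real.log L ^ 2 := by
    calc 80 * (harmonic A : ℝ) * harmonic T ≤ 80 * (2 * L) * (3 * Real.log L) := by gcongr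
      _ = 480 * L * Real.log L := by ring
      _ ≤ 480 * L * Real.log L ^ 2 := by
          gcongr
          nlinarith
  obtain ⟨m, hm, hmB, h1, h2⟩ := exists_split_sHat_le A B T (Nat.cast_pos.1 hA0)
    (Nat.le_ceil _) hT0 (by exact_mod_cast hB1) hBA hAB
  exact ⟨m, hm, hmB, h1.trans hbound, h2.trans hbound⟩
end

section
/- There exist constants C > 0 and K > 0 such that for all coprime positive integers A, B with C < B ≤ A ≤ 2B, the number of integers m ∈ {1, …, B} satisfying both ŝ(m/A) ≤ K · (log A) · (log log A)² and ŝ((B−m)/A) ≤ K · (log A) · (log log A)² is at least B/5. -/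
/-- The pairs `(q, y)` in `[1, A]²` with `q * m ≡ ± y` modulo `A`. -/
def nearPairs (A m : ℕ) : Finset (ℕ × ℕ) :=
  (Finset.Icc 1 A ×ˢ Finset.Icc 1 A).filter fun p =>
    (A : ℤ) ∣ (p.1 : ℤ) * m - p.2 ∨ (A : ℤ) ∣ (p.1 : ℤ) * m + p.2

/-- The total number, over `m < A`, of pairs `(q, y)` with `q * m ≡ ± y` modulo `A` and
`a * (q * y) ≤ A`. -/
def nearCount (A a : ℕ) : ℕ :=
  ∑ m ∈ Finset.range A, ((nearPairs A m).filter fun p => a ≤ A / (p.1 * p.2)).card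

/-- The Euclidean algorithm on `(x, y)`, with cofactors `q`, `q'` tracked modulo `A`, only visits
near pairs, and each partial quotient is at most the weight `A / (q * y)` of its pair. -/
theorem sHat_le_sum_filter {A m : ℕ} (y : ℕ) : ∀ (x q q' : ℕ) (s : ℤ), y < x → 1 ≤ q →
    q * x + q' * y = A → (s = 1 ∨ s = -1) →
    (A : ℤ) ∣ (q : ℤ) * m - s * y → (A : ℤ) ∣ (q' : ℤ) * m + s * x →
    sHat y x ≤ ∑ p ∈ (nearPairs A m).filter (fun p => p.2 ≤ y), A / (p.1 * p.2) := by
  induction y using Nat.strong_induction_on with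
  | _ y ih =>
  intro x q q' s hyx hq hA hs h1 h2
  rcases y with _ | k
  · simp [sHat]
  rw [sHat]
  set y := k + 1 with hy
  have hy0 : 0 < y := Nat.succ_pos k
  have hdm : y * (x / y) + x % y = x := Nat.div_add_mod x y
  have ha : 1 ≤ x / y := (Nat.one_le_div_iff hy0).2 hyx.le
  have hrec := ih (x % y) (Nat.mod_lt _ hy0) y (q' + x / y * q) q (-s) (Nat.mod_lt _ hy0)
    (by nlinarith [Nat.mul_le_mul ha hq])
    (by
      calc _ = q * (y * (x / y) + x % y) + q' * y := by ring
        _ = A := by rw [hdm, hA])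
    (by rcases hs with rfl | rfl <;> simp)
    (by
      have hdm' : (y : ℤ) * ((x / y : ℕ) : ℤ) + ((x % y : ℕ) : ℤ) = x := by exact_mod_cast hdm
      have h := dvd_add h2 (h1.mul_left ((x / y : ℕ) : ℤ))
      have e : ((q' + x / y * q : ℕ) : ℤ) * m - -s * ((x % y : ℕ) : ℤ)
          = (q' : ℤ) * m + s * x + ((x / y : ℕ) : ℤ) * ((q : ℤ) * m - s * y) := by
        rw [← hdm', Nat.cast_add, Nat.cast_mul]; ring
      rw [e]; exact h)
    (by simpa [sub_eq_add_neg] using h1)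
  have hqx : q * x ≤ A := by omega
  have hqA : q ≤ A := le_trans (Nat.le_mul_of_pos_right q (by omega)) hqx
  have hyA : y ≤ A := hyx.le.trans (le_trans (Nat.le_mul_of_pos_left x hq) hqx)
  have hmem : (q, y) ∈ (nearPairs A m).filter (fun p => p.2 ≤ y) := by
    simp only [nearPairs, Finset.mem_filter, Finset.mem_product, Finset.mem_Icc]
    refine ⟨⟨⟨⟨hq, hqA⟩, hy0, hyA⟩, ?_⟩, le_rfl⟩
    rcases hs with rfl | rfl
    · left; simpa using h1
    · right; simpa using h1
  rw [← Finset.add_sum_erase _ _ hmem]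
  have hfirst : x / y ≤ A / (q * y) := by
    rw [Nat.le_div_iff_mul_le (Nat.mul_pos hq hy0)]
    have : q * (x / y * y) ≤ q * x := Nat.mul_le_mul_left q (Nat.div_mul_le_self x y)
    nlinarith
  refine add_le_add hfirst (hrec.trans (Finset.sum_le_sum_of_subset ?_))
  intro p hp
  have hlt := Nat.mod_lt x hy0
  rw [Finset.mem_filter] at hp
  rw [Finset.mem_erase, Finset.mem_filter]
  refine ⟨?_, hp.1, by omega⟩
  rintro rfl
  have := hp.2
  omega

theorem sHat_le_sum_nearPairs {A m : ℕ} (hm : m < A) :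
    sHat m A ≤ ∑ p ∈ nearPairs A m, A / (p.1 * p.2) :=
  (sHat_le_sum_filter m A 1 0 1 hm le_rfl (by simp) (Or.inl rfl) (by simp) (by simp)).trans
    (Finset.sum_le_sum_of_subset (Finset.filter_subset _ _))

theorem card_dvd_mul_sub_le {A : ℕ} (hA : 0 < A) (q : ℕ) (c : ℤ) :
    ((Finset.range A).filter fun m : ℕ => (A : ℤ) ∣ (q : ℤ) * m - c).card ≤
      if ((A.gcd q : ℕ) : ℤ) ∣ c then A.gcd q else 0 := by
  have hg : 0 < A.gcd q := Nat.gcd_pos_of_pos_left q hA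
  split_ifs with h
  · have hd : 0 < A / A.gcd q := Nat.div_pos (Nat.gcd_le_left q hA) hg
    rw [← Finset.card_range (A.gcd q)]
    refine Finset.card_le_card_of_injOn (fun m => m / (A / A.gcd q)) ?_ ?_
    · intro m hm
      simp only [Finset.coe_filter, Finset.mem_range, Set.mem_ofPred_eq] at hm
      simp only [Finset.coe_range, Set.mem_Iio]
      rw [Nat.div_lt_iff_lt_mul hd, Nat.mul_div_cancel' (Nat.gcd_dvd_left A q)]
      exact hm.1
    · intro m hm n hn hmn
      simp only [Finset.coe_filter, Finset.mem_range, Set.mem_ofPred_eq] at hm hn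
      have hmod : q * m ≡ q * n [MOD A] := by
        rw [← Int.natCast_modEq_iff, Int.modEq_iff_dvd]
        have e : ((q * n : ℕ) : ℤ) - (q * m : ℕ) = (q * n - c) - (q * m - c) := by
          push_cast; ring
        rw [e]
        exact dvd_sub hn.2 hm.2
      have hmod' := Nat.ModEq.cancel_left_div_gcd hA hmod
      have hmn' : m / (A / A.gcd q) = n / (A / A.gcd q) := hmn
      rw [← Nat.div_add_mod m (A / A.gcd q), ← Nat.div_add_mod n (A / A.gcd q), hmn', hmod']
  · rw [Nat.le_zero, Finset.card_eq_zero, Finset.filter_eq_empty_iff]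
    intro m _ hm
    apply h
    have h1 : ((A.gcd q : ℕ) : ℤ) ∣ (q : ℤ) * m - c :=
      (Int.natCast_dvd_natCast.2 (Nat.gcd_dvd_left A q)).trans hm
    have h2 : ((A.gcd q : ℕ) : ℤ) ∣ (q : ℤ) * m :=
      (Int.natCast_dvd_natCast.2 (Nat.gcd_dvd_right A q)).mul_right _
    exact (dvd_sub_right h2).1 h1

theorem sum_ite_dvd_le (g R : ℕ) :
    ∑ y ∈ Finset.Icc 1 R, (if g ∣ y then g else 0) ≤ R := by
  rw [← Finset.sum_filter, Finset.sum_const, smul_eq_mul]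
  have : ((Finset.Icc 1 R).filter fun y => g ∣ y).card = R / g := by
    rw [← Nat.Ioc_filter_dvd_card_eq_div]; rfl
  rw [this]
  exact Nat.div_mul_le_self R g

theorem nearCount_le_sum {A a : ℕ} (hA : 0 < A) (ha : 1 ≤ a) :
    nearCount A a ≤ ∑ q ∈ Finset.Icc 1 A, 2 * (A / (a * q)) := by
  have hcount : nearCount A a = ∑ q ∈ Finset.Icc 1 A, ∑ y ∈ Finset.Icc 1 A,
      if a ≤ A / (q * y) then ((Finset.range A).filter fun m : ℕ =>
        (A : ℤ) ∣ (q : ℤ) * m - y ∨ (A : ℤ) ∣ (q : ℤ) * m + y).card else 0 := by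
    simp only [nearCount, nearPairs, Finset.card_filter, Finset.filter_filter]
    rw [Finset.sum_comm' (s' := fun _ => Finset.range A) (t' := Finset.Icc 1 A ×ˢ Finset.Icc 1 A)
      (by simp [and_comm]), Finset.sum_product]
    refine Finset.sum_congr rfl fun q _ => Finset.sum_congr rfl fun y _ => ?_
    split_ifs with h <;> simp [h]
  rw [hcount]
  refine Finset.sum_le_sum fun q hq => ?_
  have hq1 : 1 ≤ q := (Finset.mem_Icc.1 hq).1
  rw [← Finset.sum_filter]
  have hsub : (Finset.Icc 1 A).filter (fun y => a ≤ A / (q * y)) ⊆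
      Finset.Icc 1 (A / (a * q)) := by
    intro y hy
    simp only [Finset.mem_filter, Finset.mem_Icc] at hy ⊢
    refine ⟨hy.1.1, ?_⟩
    have h := hy.2
    rw [Nat.le_div_iff_mul_le (Nat.mul_pos hq1 hy.1.1)] at h
    rw [Nat.le_div_iff_mul_le (Nat.mul_pos ha hq1)]
    calc y * (a * q) = a * (q * y) := by ring
      _ ≤ A := h
  refine (Finset.sum_le_sum_of_subset hsub).trans ?_
  calc _ ≤ ∑ y ∈ Finset.Icc 1 (A / (a * q)), 2 * (if A.gcd q ∣ y then A.gcd q else 0) := by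
        refine Finset.sum_le_sum fun y _ => ?_
        rw [Finset.filter_or, two_mul]
        refine (Finset.card_union_le _ _).trans (add_le_add ?_ ?_)
        · simpa [Int.natCast_dvd_natCast] using card_dvd_mul_sub_le hA q (y : ℤ)
        · simpa [Int.natCast_dvd_natCast] using card_dvd_mul_sub_le hA q (-(y : ℤ))
    _ ≤ 2 * (A / (a * q)) := by
        rw [← Finset.mul_sum]
        exact Nat.mul_le_mul_left 2 (sum_ite_dvd_le _ _)

theorem sum_Icc_inv_le (n : ℕ) : ∑ i ∈ Finset.Icc 1 n, (i : ℝ)⁻¹ ≤ 1 + Real.log n := by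
  have h := harmonic_le_one_add_log n
  rw [harmonic_eq_sum_Icc] at h
  push_cast at h
  exact h

theorem nearCount_le {A a : ℕ} (hA : 0 < A) (ha : 1 ≤ a) :
    (nearCount A a : ℝ) ≤ 2 * A * (1 + Real.log A) * (a : ℝ)⁻¹ := by
  calc (nearCount A a : ℝ) ≤ ((∑ q ∈ Finset.Icc 1 A, 2 * (A / (a * q)) : ℕ) : ℝ) := by
        exact_mod_cast nearCount_le_sum hA ha
    _ ≤ ∑ q ∈ Finset.Icc 1 A, 2 * A * (a : ℝ)⁻¹ * (q : ℝ)⁻¹ := by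
        push_cast
        refine Finset.sum_le_sum fun q _ => ?_
        have h : ((A / (a * q) : ℕ) : ℝ) ≤ (A : ℝ) / ((a * q : ℕ) : ℝ) := Nat.cast_div_le
        push_cast at h
        calc 2 * ((A / (a * q) : ℕ) : ℝ) ≤ 2 * ((A : ℝ) / (a * q)) := by linarith
          _ = _ := by rw [div_eq_mul_inv, mul_inv]; ring
    _ ≤ 2 * A * (a : ℝ)⁻¹ * (1 + Real.log A) := by
        rw [← Finset.mul_sum]
        exact mul_le_mul_of_nonneg_left (sum_Icc_inv_le A) (by positivity)
    _ = _ := by ring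

/-- A union bound for the pairs of weight exceeding `T`, combined with Markov's inequality for the
weights truncated at `T`. -/
theorem mul_card_lt_sHat_le (A T : ℕ) {L : ℝ} (hL : 0 ≤ L) :
    L * ((Finset.range A).filter fun m => L < sHat m A).card ≤
      L * nearCount A (T + 1) + ∑ a ∈ Finset.Icc 1 T, (nearCount A a : ℝ) := by
  have hpt : ∀ m ∈ (Finset.range A).filter (fun m => L < sHat m A),
      L ≤ L * ((nearPairs A m).filter fun p => T + 1 ≤ A / (p.1 * p.2)).card +
        ∑ a ∈ Finset.Icc 1 T, (((nearPairs A m).filter fun p => a ≤ A / (p.1 * p.2)).card : ℝ) := by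
    intro m hm
    rw [Finset.mem_filter, Finset.mem_range] at hm
    rcases Finset.eq_empty_or_nonempty
      ((nearPairs A m).filter fun p => T + 1 ≤ A / (p.1 * p.2)) with he | hne
    · rw [he]
      rw [Finset.filter_eq_empty_iff] at he
      have hsum : ∑ p ∈ nearPairs A m, A / (p.1 * p.2) =
          ∑ a ∈ Finset.Icc 1 T, ((nearPairs A m).filter fun p => a ≤ A / (p.1 * p.2)).card := by
        simp only [Finset.card_filter]
        rw [Finset.sum_comm]
        refine Finset.sum_congr rfl fun p hp => ?_
        have hT := he hp
        rw [← Finset.card_filter]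
        have : (Finset.Icc 1 T).filter (fun a => a ≤ A / (p.1 * p.2)) =
            Finset.Icc 1 (A / (p.1 * p.2)) := by
          ext a
          simp only [Finset.mem_filter, Finset.mem_Icc]
          omega
        rw [this, Nat.card_Icc, Nat.add_sub_cancel]
      have h := sHat_le_sum_nearPairs hm.1
      rw [hsum] at h
      have h' : (sHat m A : ℝ) ≤ ∑ a ∈ Finset.Icc 1 T,
          (((nearPairs A m).filter fun p => a ≤ A / (p.1 * p.2)).card : ℝ) := by exact_mod_cast h
      simp only [Finset.card_empty, Nat.cast_zero, mul_zero, zero_add]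
      exact hm.2.le.trans h'
    · have h1 : (1 : ℝ) ≤ ((nearPairs A m).filter fun p => T + 1 ≤ A / (p.1 * p.2)).card := by
        exact_mod_cast hne.card_pos
      have h2 : (0 : ℝ) ≤ ∑ a ∈ Finset.Icc 1 T,
          (((nearPairs A m).filter fun p => a ≤ A / (p.1 * p.2)).card : ℝ) := by positivity
      nlinarith
  calc _ = ∑ m ∈ (Finset.range A).filter (fun m => L < sHat m A), L := by
        rw [Finset.sum_const, nsmul_eq_mul, mul_comm]
    _ ≤ _ := Finset.sum_le_sum hpt
    _ ≤ ∑ m ∈ Finset.range A,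
        (L * ((nearPairs A m).filter fun p => T + 1 ≤ A / (p.1 * p.2)).card +
        ∑ a ∈ Finset.Icc 1 T,
          (((nearPairs A m).filter fun p => a ≤ A / (p.1 * p.2)).card : ℝ)) :=
        Finset.sum_le_sum_of_subset_of_nonneg (Finset.filter_subset _ _)
          fun m _ _ => by positivity
    _ = _ := by
        rw [Finset.sum_add_distrib, ← Finset.mul_sum, Finset.sum_comm]
        simp only [nearCount, Nat.cast_sum]

theorem card_lt_sHat_le {A : ℕ} {L : ℝ} (hA : Real.exp (Real.exp 1) < A)
    (hL : 1640 * Real.log A * (Real.log (Real.log A)) ^ 2 ≤ L) :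
    (((Finset.range A).filter fun m => L < sHat m A).card : ℝ) ≤ A / 5 := by
  have hA0 : (0 : ℝ) < A := (Real.exp_pos _).trans hA
  have hl : Real.exp 1 < Real.log A := (Real.lt_log_iff_exp_lt hA0).2 hA
  have hl1 : 1 < Real.log A := by linarith [Real.add_one_le_exp (1 : ℝ)]
  have hu : 1 < Real.log (Real.log A) := (Real.lt_log_iff_exp_lt (by linarith)).2 hl
  set l := Real.log A
  set u := Real.log l
  set T := ⌊20 * (1 + l)⌋₊
  have hT1 : 20 * (1 + l) < (T : ℝ) + 1 := Nat.lt_floor_add_one _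
  have hT2 : (T : ℝ) ≤ 20 * (1 + l) := Nat.floor_le (by linarith)
  have hT0 : (0 : ℝ) < T := by linarith
  have hlogT : Real.log T ≤ 39 + u := by
    calc Real.log T ≤ Real.log (40 * l) := Real.log_le_log hT0 (by linarith)
      _ = Real.log 40 + u := Real.log_mul (by norm_num) (by linarith)
      _ ≤ 39 + u := by linarith [Real.log_le_sub_one_of_pos (show (0 : ℝ) < 40 by norm_num)]
  have hL' : 20 * (1 + l) * (1 + Real.log T) ≤ L := by
    have h1 : 1 + Real.log T ≤ 41 * u ^ 2 := by nlinarith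
    calc 20 * (1 + l) * (1 + Real.log T) ≤ 20 * (1 + l) * (41 * u ^ 2) :=
          mul_le_mul_of_nonneg_left h1 (by linarith)
      _ ≤ 1640 * l * u ^ 2 := by nlinarith [sq_nonneg u]
      _ ≤ L := hL
  have hLpos : 0 < L := lt_of_lt_of_le (by positivity) hL
  have hAnat : 0 < A := by exact_mod_cast hA0
  have hmain := mul_card_lt_sHat_le A T hLpos.le
  have hlarge : (nearCount A (T + 1) : ℝ) ≤ A / 10 := by
    refine (nearCount_le hAnat (Nat.le_add_left 1 T)).trans ?_
    rw [← div_eq_mul_inv, div_le_iff₀ (by positivity)]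
    push_cast
    nlinarith
  have hsmall : ∑ a ∈ Finset.Icc 1 T, (nearCount A a : ℝ) ≤ L * (A / 10) := by
    calc ∑ a ∈ Finset.Icc 1 T, (nearCount A a : ℝ)
        ≤ ∑ a ∈ Finset.Icc 1 T, 2 * A * (1 + l) * (a : ℝ)⁻¹ :=
          Finset.sum_le_sum fun a ha => nearCount_le hAnat (Finset.mem_Icc.1 ha).1
      _ ≤ 2 * A * (1 + l) * (1 + Real.log T) := by
          rw [← Finset.mul_sum]
          exact mul_le_mul_of_nonneg_left (sum_Icc_inv_le T) (by positivity)
      _ = 20 * (1 + l) * (1 + Real.log T) * (A / 10) := by ring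
      _ ≤ L * (A / 10) := mul_le_mul_of_nonneg_right hL' (by positivity)
  have : L * (((Finset.range A).filter fun m => L < sHat m A).card : ℝ) ≤ L * (A / 5) := by
    nlinarith [mul_le_mul_of_nonneg_left hlarge hLpos.le]
  exact le_of_mul_le_mul_left this hLpos

/-- There are constants `C, K > 0` such that for all coprime `A, B` with
`C < B ≤ A ≤ 2B`, at least `B/5` of the integers `m ∈ {1, …, B}` satisfy both
`ŝ(m/A) ≤ K·(log A)·(log log A)²` and `ŝ((B-m)/A) ≤ K·(log A)·(log log A)²`. -/
theorem many_small_quotient_splits :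
    ∃ C K : ℝ, 0 < C ∧ 0 < K ∧
      ∀ A B : ℕ, Nat.Coprime A B → C < (B : ℝ) → B ≤ A → A ≤ 2 * B →
        (B : ℝ) / 5 ≤
          ({m : ℕ | 1 ≤ m ∧ m ≤ B ∧
            (sHat m A : ℝ) ≤ K * Real.log A * (Real.log (Real.log A)) ^ 2 ∧
            (sHat (B - m) A : ℝ) ≤ K * Real.log A * (Real.log (Real.log A)) ^ 2}.ncard : ℝ) := by
  refine ⟨Real.exp (Real.exp 1), 1640, Real.exp_pos _, by norm_num, ?_⟩
  intro A B hcop hB hBA hAB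
  have hBAr : (B : ℝ) ≤ A := by exact_mod_cast hBA
  have hABr : (A : ℝ) ≤ 2 * B := by exact_mod_cast hAB
  have hB1 : 1 < B := by
    have : (1 : ℝ) < B := (Real.one_lt_exp_iff.2 (Real.exp_pos 1)).trans hB
    exact_mod_cast this
  have hlt : B < A := by
    refine lt_of_le_of_ne hBA ?_
    rintro rfl
    rw [Nat.coprime_self] at hcop
    omega
  set L : ℝ := 1640 * Real.log A * (Real.log (Real.log A)) ^ 2
  set bad := (Finset.range A).filter fun m => L < sHat m A
  have hcard : (bad.card : ℝ) ≤ A / 5 := card_lt_sHat_le (hB.trans_le hBAr) le_rfl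
  set good := (Finset.Icc 1 B).filter fun m => (sHat m A : ℝ) ≤ L ∧ (sHat (B - m) A : ℝ) ≤ L
    with hgood
  have hset : {m : ℕ | 1 ≤ m ∧ m ≤ B ∧ (sHat m A : ℝ) ≤ L ∧ (sHat (B - m) A : ℝ) ≤ L} =
      (good : Set ℕ) := by
    ext m
    simp [hgood, and_assoc]
  rw [hset, Set.ncard_coe_finset]
  have hcover : Finset.Icc 1 B ⊆ good ∪ (bad ∪ bad.image fun m => B - m) := by
    intro m hm
    have hm' := Finset.mem_Icc.1 hm
    by_cases h1 : (sHat m A : ℝ) ≤ L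
    · by_cases h2 : (sHat (B - m) A : ℝ) ≤ L
      · exact Finset.mem_union_left _ (Finset.mem_filter.2 ⟨hm, h1, h2⟩)
      · refine Finset.mem_union_right _ (Finset.mem_union_right _ (Finset.mem_image.2
          ⟨B - m, Finset.mem_filter.2 ⟨Finset.mem_range.2 (by omega), not_le.1 h2⟩, by omega⟩))
    · exact Finset.mem_union_right _ (Finset.mem_union_left _
        (Finset.mem_filter.2 ⟨Finset.mem_range.2 (by omega), not_le.1 h1⟩))
  have hle : B ≤ good.card + (bad.card + bad.card) := by
    calc B = (Finset.Icc 1 B).card := by simp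
      _ ≤ _ := Finset.card_le_card hcover
      _ ≤ good.card + (bad ∪ bad.image fun m => B - m).card := Finset.card_union_le _ _
      _ ≤ _ := Nat.add_le_add_left ((Finset.card_union_le _ _).trans
          (Nat.add_le_add_left Finset.card_image_le _)) _
  have hle' : (B : ℝ) ≤ good.card + (bad.card + bad.card) := by exact_mod_cast hle
  linarith
end
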